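/- Let ν be a partition. Then for sufficiently large n, the restriction of the irreducible S_{2n}-representation V^{ν[2n]'} (indexed by the conjugate of ν[2n]) to the hyperoctahedral subgroup H_n decomposes as ⊕_{λ,μ} K̄^ν_{λ,μ} V^{μ, λ[n−|μ|]}, where K̄^ν_{λ,μ} are the same stable coefficients as in the decomposition of Res(V^{ν[2n]}) = ⊕ K̄^ν_{λ,μ} V^{λ[n−|μ|],μ}. -/

import Mathlib

open MvPolynomial Finset

/-- The ring of symmetric functions (with rational coefficients), realized as the free
commutative `ℚ`-algebra on the complete homogeneous symmetric functions `h₁, h₂, …`,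
where the variable `n : ℕ` corresponds to `h_{n+1}`. -/
abbrev SymFn : Type := MvPolynomial ℕ ℚ

/-- The complete homogeneous symmetric function `h_n`, with `h_n = 0` for `n < 0`
and `h_0 = 1`. -/
noncomputable def hh (n : ℤ) : SymFn :=
  if n < 0 then 0 else if n = 0 then 1 else MvPolynomial.X (n.toNat - 1)

/-- The power sum symmetric functions, defined from the `h`'s by Newton's identities:
`p_k = k h_k - ∑_{i=1}^{k-1} h_i p_{k-i}`. -/
noncomputable def pp : ℕ → SymFn
  | 0 => 0
  | (k+1) => ((k : ℚ) + 1) • hh (k+1) - ∑ i ∈ Finset.range k, hh (i+1) * pp (k - i)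
  decreasing_by exact Nat.lt_succ_of_le (Nat.sub_le _ _)

/-- `h_m` written as a polynomial in the power sums (the variable `j` stands for `p_{j+1}`),
via the recursion `m h_m = ∑_{i=1}^{m} p_i h_{m-i}`. -/
noncomputable def hInP : ℕ → MvPolynomial ℕ ℚ
  | 0 => 1
  | (m+1) => ((m : ℚ) + 1)⁻¹ •
      ∑ i ∈ Finset.range (m+1), MvPolynomial.X i * hInP (m - i)
  decreasing_by exact Nat.lt_succ_of_le (Nat.sub_le _ _)

/-- The `k`-th Adams operation: the algebra endomorphism of `SymFn` determined by
`p_m ↦ p_{k m}` on power sums. -/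
noncomputable def adams (k : ℕ) : SymFn →ₐ[ℚ] SymFn :=
  aeval fun m => (aeval fun j => pp (k * (j+1))) (hInP (m+1))

/-- The plethysm `h_k ∘ g`, via the recursion
`k (h_k ∘ g) = ∑_{i=1}^{k} (p_i ∘ g) (h_{k-i} ∘ g)`, where `p_i ∘ g = adams i g`. -/
noncomputable def hPleth (g : SymFn) : ℕ → SymFn
  | 0 => 1
  | (k+1) => ((k : ℚ) + 1)⁻¹ •
      ∑ i ∈ Finset.range (k+1), adams (i+1) g * hPleth g (k - i)
  decreasing_by exact Nat.lt_succ_of_le (Nat.sub_le _ _)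

/-- The (outer) plethysm `f ∘ g` of symmetric functions: the algebra homomorphism
in the left argument sending `h_k ↦ h_k ∘ g`. -/
noncomputable def pleth (f g : SymFn) : SymFn := aeval (fun m => hPleth g (m+1)) f

/-- The elementary symmetric functions, via `e_k = ∑_{i=1}^{k} (-1)^{i-1} h_i e_{k-i}`. -/
noncomputable def ee : ℕ → SymFn
  | 0 => 1
  | (k+1) => ∑ i ∈ Finset.range (k+1), ((-1 : ℚ))^i • (hh (i+1) * ee (k - i))
  decreasing_by exact Nat.lt_succ_of_le (Nat.sub_le _ _)

/-- The parts of a multiset, as a weakly decreasing list. -/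
def sortedParts (m : Multiset ℕ) : List ℕ := (m.sort (· ≤ ·)).reverse

/-- The Schur function `s_m`, via the Jacobi–Trudi determinant
`s_λ = det (h_{λ_i + j - i})`. -/
noncomputable def schur (m : Multiset ℕ) : SymFn :=
  Matrix.det (Matrix.of fun i j : Fin (Multiset.card m) =>
    hh (((sortedParts m).getD i 0 : ℤ) + (j : ℤ) - (i : ℤ)))

/-- A multiset of naturals is a partition when all its parts are positive. -/
def IsPartition (m : Multiset ℕ) : Prop := 0 ∉ m

/-- A strict partition: positive, pairwise distinct parts. -/
def IsStrictPartition (m : Multiset ℕ) : Prop := 0 ∉ m ∧ m.Nodup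

/-- The first (largest) part `λ₁` of a partition. -/
def firstPart (m : Multiset ℕ) : ℕ := m.sup

/-- The size `|λ|` of a partition. -/
def psize (m : Multiset ℕ) : ℕ := m.sum

/-- The conjugate (transposed) partition. -/
def conj (m : Multiset ℕ) : Multiset ℕ :=
  ((List.range m.sup).map fun i => Multiset.card (m.filter fun x => i < x) : List ℕ)

/-- The partition `ν[N] = (N - |ν|, ν₁, ν₂, …)` (valid when `N ≥ |ν| + ν₁`). -/
def padded (ν : Multiset ℕ) (N : ℕ) : Multiset ℕ := (N - ν.sum) ::ₘ ν

/-- `c` is the expansion of `f` in the basis of Schur functions indexed by partitions. -/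
def SchurExpansion (f : SymFn) (c : Multiset ℕ →₀ ℚ) : Prop :=
  (∀ κ ∈ c.support, IsPartition κ) ∧ f = c.sum fun κ a => a • schur κ

/-- `Φ` of a Schur expansion: the largest first part of a partition occurring in it. -/
def Phi (c : Multiset ℕ →₀ ℚ) : ℕ := c.support.sup firstPart

/-- The partition `2α`, doubling every part. -/
def double (m : Multiset ℕ) : Multiset ℕ := m.map (2 * ·)

/-- For a strict partition `β = (β₁ > β₂ > … > β_r > 0)`, the partition `Γ(β)` with
Frobenius coordinates `(β₁ - 1, …, β_r - 1 | β₁, …, β_r)`. -/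
def gammaFrob (β : Multiset ℕ) : Multiset ℕ :=
  let b := sortedParts β
  let r := b.length
  (((List.range r).map fun i => b.getD i 0 + i)
    ++ ((List.range (b.getD 0 0 + 1 - r)).map fun t =>
        ((List.range r).filter fun j => r + t ≤ b.getD j 0 + j).length) : List ℕ)


section PartOne

open PowerSeries in
theorem coeff_Xd {R : Type*} [CommRing R] (f : PowerSeries R) (n : ℕ) :
    PowerSeries.coeff n (PowerSeries.X * PowerSeries.derivative R f) = (n : R) * PowerSeries.coeff n f := by
  cases n with
  | zero => simp
  | succ n => 
    rw [PowerSeries.coeff_succ_X_mul, PowerSeries.coeff_derivative]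
    push_cast; ring

theorem hh_neg {n : ℤ} (h : n < 0) : hh n = 0 := by simp [hh, h]
theorem hh_zero : hh 0 = 1 := by simp [hh]
theorem hh_succ (n : ℕ) : hh ((n : ℤ) + 1) = MvPolynomial.X n := by
  have h1 : ¬ ((n : ℤ) + 1 < 0) := by omega
  have h2 : ¬ ((n : ℤ) + 1 = 0) := by omega
  have h3 : ((n : ℤ) + 1).toNat - 1 = n := by omega
  simp only [hh, h1, h2, if_false, h3]

/-- generating series of the series h -/
noncomputable def Hser : PowerSeries SymFn := PowerSeries.mk fun n => hh n
/-- generating series of the series e -/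
noncomputable def Eser : PowerSeries SymFn := PowerSeries.mk fun n => ee n
/-- generating series of the signed series e -/
noncomputable def Eneg : PowerSeries SymFn := PowerSeries.mk fun n => (-1) ^ n * ee n
/-- generating series of the series p -/
noncomputable def Pser : PowerSeries SymFn := PowerSeries.mk fun n => pp n

theorem rescale_Eser : PowerSeries.rescale (-1 : SymFn) Eser = Eneg := by
  ext1 n; simp [Eser, Eneg, PowerSeries.coeff_rescale]

theorem HE : Hser * Eneg = 1 := by
  ext1 n
  rw [PowerSeries.coeff_mul, Finset.Nat.sum_antidiagonal_eq_sum_range_succ_mk]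
  cases n with
  | zero => simp [Hser, Eneg, hh_zero, ee]
  | succ k =>
    rw [Finset.sum_range_succ']
    simp only [Hser, Eneg, PowerSeries.coeff_mk, PowerSeries.coeff_one]
    rw [show ee (k + 1 - 0) = _ from by rw [Nat.sub_zero, ee]]
    simp only [Nat.cast_zero, hh_zero, one_mul, Nat.sub_zero, Finset.mul_sum]
    rw [← Finset.sum_add_distrib]
    simp only [Nat.succ_ne_zero, if_false]
    refine Finset.sum_eq_zero fun i hi => ?_
    have hi' : i ≤ k := by simpa [Nat.lt_succ_iff] using hi
    obtain ⟨j, rfl⟩ := Nat.exists_eq_add_of_le hi'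
    have e1 : i + j + 1 - (i + 1) = j := by omega
    have e2 : i + j - i = j := by omega
    rw [e1, e2, MvPolynomial.smul_eq_C_mul, map_pow, map_neg, map_one]
    push_cast
    have : ((-1 : SymFn) ^ i) * (-1) ^ i = 1 := by rw [← mul_pow]; simp
    rw [show i + j + 1 = i + (j + 1) by ring, pow_add, pow_succ]
    linear_combination (-(hh (i+1) * (-1)^j * ee j)) * this

theorem PH : Pser * Hser = PowerSeries.X * PowerSeries.derivative SymFn Hser := by
  ext1 n
  rw [coeff_Xd, PowerSeries.coeff_mul, Finset.Nat.sum_antidiagonal_eq_sum_range_succ_mk]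
  cases n with
  | zero => simp [Pser, pp]
  | succ k =>
    rw [Finset.sum_range_succ]
    rw [← Finset.sum_range_reflect]
    rw [Finset.sum_range_succ]
    simp only [Hser, Pser, PowerSeries.coeff_mk]
    have e1 : ∀ j : ℕ, k + 1 - 1 - j = k - j := fun j => by omega
    simp only [e1, Nat.sub_self, Nat.sub_zero, Nat.cast_zero, hh_zero, mul_one]
    rw [show pp (k+1) = _ from by rw [pp]]
    rw [show pp 0 = 0 from by rw [pp], zero_mul, add_zero]
    have : ∑ x ∈ Finset.range k, pp (k - x) * hh ((k + 1 - (k - x) : ℕ) : ℤ) =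
       ∑ i ∈ Finset.range k, hh (i + 1) * pp (k - i) := by
      refine Finset.sum_congr rfl fun i hi => ?_
      have hi' := Finset.mem_range.1 hi
      rw [show k + 1 - (k - i) = i + 1 by omega, mul_comm]; push_cast; rfl
    rw [this, MvPolynomial.smul_eq_C_mul]
    push_cast
    simp

/-- the involution `ω` -/
noncomputable def om : SymFn →ₐ[ℚ] SymFn := aeval fun m => ee (m + 1)

theorem om_hh (n : ℕ) : om (hh n) = ee n := by
  cases n with
  | zero => simp [hh_zero, ee]
  | succ n => push_cast; rw [hh_succ]; simp [om]

theorem om_hh_neg {n : ℤ} (h : n < 0) : om (hh n) = 0 := by rw [hh_neg h, map_zero]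

theorem map_Xd {R S : Type*} [CommRing R] [CommRing S] (f : R →+* S) (a : PowerSeries R) :
    PowerSeries.map f (PowerSeries.X * PowerSeries.derivative R a) =
      PowerSeries.X * PowerSeries.derivative S (PowerSeries.map f a) := by
  ext1 n; rw [PowerSeries.coeff_map, coeff_Xd, coeff_Xd]; simp

theorem om_pp_ser : PowerSeries.map om.toRingHom Pser = - PowerSeries.rescale (-1) Pser := by
  have h1 := congrArg (PowerSeries.map om.toRingHom) PH
  rw [map_Xd, map_mul] at h1
  have hH : PowerSeries.map om.toRingHom Hser = Eser := by
    ext1 n; simp [Hser, Eser, om_hh]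
  rw [hH] at h1
  have hd := congrArg (PowerSeries.derivative SymFn) HE
  rw [Derivation.leibniz, Derivation.map_one_eq_zero] at hd
  simp only [smul_eq_mul] at hd
  have h2 : Eneg * Pser = - (PowerSeries.X * PowerSeries.derivative SymFn Eneg) := by
    linear_combination (Pser * Eneg + PowerSeries.X * PowerSeries.derivative SymFn Eneg) * (-HE) + (Eneg * Eneg) * PH + PowerSeries.X * Eneg * hd
  have h3 : Eser * PowerSeries.rescale (-1) Pser =
      - (PowerSeries.X * PowerSeries.derivative SymFn Eser) := by
    have := congrArg (PowerSeries.rescale (-1 : SymFn)) h2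
    rw [map_mul, ← rescale_Eser, PowerSeries.rescale_rescale] at this
    simp only [mul_neg, mul_one, neg_neg, PowerSeries.rescale_one, RingHom.id_apply] at this
    rw [this]
    ext1 n
    simp only [map_neg, PowerSeries.coeff_rescale, coeff_Xd]
    have : ((-1 : SymFn) ^ n) * (-1) ^ n = 1 := by rw [← mul_pow]; simp
    linear_combination -(n * PowerSeries.coeff n Eser) * this
  have hu : PowerSeries.rescale (-1) Hser * Eser = 1 := by
    have := congrArg (PowerSeries.rescale (-1 : SymFn)) HE
    rw [map_mul, ← rescale_Eser, PowerSeries.rescale_rescale] at this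
    simpa using this
  linear_combination (-(PowerSeries.map om.toRingHom Pser) - PowerSeries.rescale (-1) Pser) * hu
    + PowerSeries.rescale (-1) Hser * (h1 + h3)

theorem om_pp (n : ℕ) : om (pp n) = - ((-1) ^ n * pp n) := by
  have := congrArg (PowerSeries.coeff n) om_pp_ser
  simpa [Pser, PowerSeries.coeff_rescale] using this

theorem hInP_one : hInP 1 = MvPolynomial.X 0 := by
  rw [hInP]; simp [hInP]

theorem hInP_two : hInP 2 = (2 : ℚ)⁻¹ • (MvPolynomial.X 0 * MvPolynomial.X 0 + MvPolynomial.X 1) := by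
  rw [hInP]; simp [Finset.sum_range_succ, hInP_one, show hInP 0 = 1 by rw [hInP]]; norm_num

theorem hh_one' : hh 1 = MvPolynomial.X 0 := by simpa using hh_succ 0
theorem hh_two' : hh 2 = MvPolynomial.X 1 := by simpa using hh_succ 1
theorem ee_two : ee 2 = hh 1 * hh 1 - hh 2 := by
  rw [ee]; simp [Finset.sum_range_succ, ee]; ring

theorem adams_h1 (k : ℕ) : adams k (hh 1) = pp k := by
  rw [hh_one']; simp [adams, hInP_one]

theorem adams_h2 (k : ℕ) : adams k (hh 2) = (2 : ℚ)⁻¹ • (pp k * pp k + pp (2 * k)) := by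
  rw [hh_two']; simp [adams, hInP_two, mul_comm]

theorem adams_e2 (k : ℕ) : adams k (ee 2) = (2 : ℚ)⁻¹ • (pp k * pp k - pp (2 * k)) := by
  rw [ee_two, map_sub, map_mul, adams_h1, adams_h2]
  have : pp k * pp k = (2 : ℚ)⁻¹ • (pp k * pp k + pp k * pp k) := by
    rw [← two_smul ℚ, smul_smul]; norm_num
  rw [sub_eq_iff_eq_add, ← smul_add]
  convert this using 2; ring

theorem om_adams_h2 (k : ℕ) : om (adams k (hh 2)) = adams k (ee 2) := by
  rw [adams_h2, adams_e2, map_smul, map_add, map_mul, om_pp, om_pp]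
  congr 1
  have : ((-1 : SymFn) ^ k) * (-1) ^ k = 1 := by rw [← mul_pow]; simp
  rw [pow_mul]
  simp only [even_two, Even.neg_pow, one_pow, one_mul]
  linear_combination (pp k * pp k) * this

theorem om_adams_e2 (k : ℕ) : om (adams k (ee 2)) = adams k (hh 2) := by
  rw [adams_h2, adams_e2, map_smul, map_sub, map_mul, om_pp, om_pp]
  congr 1
  have : ((-1 : SymFn) ^ k) * (-1) ^ k = 1 := by rw [← mul_pow]; simp
  rw [pow_mul]
  simp only [even_two, Even.neg_pow, one_pow, one_mul]
  linear_combination (pp k * pp k) * this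

/-- the sequence `h` determined by the power sums `q i = p_{i+1}` -/
noncomputable def Hs {R : Type*} [CommRing R] [Algebra ℚ R] (q : ℕ → R) : ℕ → R
  | 0 => 1
  | (k+1) => ((k : ℚ) + 1)⁻¹ •
      ∑ i ∈ Finset.range (k+1), q i * Hs q (k - i)
  decreasing_by exact Nat.lt_succ_of_le (Nat.sub_le _ _)

theorem Hs_zero {R : Type*} [CommRing R] [Algebra ℚ R] (q : ℕ → R) : Hs q 0 = 1 := by rw [Hs]

theorem hPleth_eq (g : SymFn) (k : ℕ) : hPleth g k = Hs (fun i => adams (i+1) g) k := by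
  induction k using Nat.strong_induction_on with
  | _ k ih =>
    cases k with
    | zero => rw [hPleth, Hs]
    | succ k =>
      rw [hPleth, Hs]
      congr 1
      refine Finset.sum_congr rfl fun i hi => ?_
      rw [ih (k - i) (by omega)]

theorem map_Hs {R S : Type*} [CommRing R] [Algebra ℚ R] [CommRing S] [Algebra ℚ S]
    (f : R →ₐ[ℚ] S) (q : ℕ → R) (k : ℕ) : f (Hs q k) = Hs (fun i => f (q i)) k := by
  induction k using Nat.strong_induction_on with
  | _ k ih =>
    cases k with
    | zero => rw [Hs, Hs, map_one]
    | succ k =>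
      rw [Hs, Hs, map_smul, map_sum]
      congr 1
      refine Finset.sum_congr rfl fun i hi => ?_
      rw [map_mul, ih (k - i) (by omega)]

theorem om_pleth_h2 (f : SymFn) : om (pleth f (hh 2)) = pleth f (ee 2) := by
  unfold pleth
  rw [← AlgHom.comp_apply, comp_aeval]
  congr 2; funext m
  simp only [hPleth_eq, map_Hs, om_adams_h2]

theorem om_pleth_e2 (f : SymFn) : om (pleth f (ee 2)) = pleth f (hh 2) := by
  unfold pleth
  rw [← AlgHom.comp_apply, comp_aeval]
  congr 2; funext m
  simp only [hPleth_eq, map_Hs, om_adams_e2]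

/-- generating series of `Hs` -/
theorem Hs_ser {R : Type*} [CommRing R] [Algebra ℚ R] (q : ℕ → R) (W : PowerSeries R) :
    (PowerSeries.constantCoeff W = 1 ∧ PowerSeries.X * PowerSeries.derivative R W =
      PowerSeries.X * PowerSeries.mk q * W) ↔ W = PowerSeries.mk (Hs q) := by
  have key : ∀ (W : PowerSeries R) (k : ℕ), PowerSeries.coeff (k+1) (PowerSeries.X * PowerSeries.mk q * W)
      = ∑ i ∈ Finset.range (k+1), q i * PowerSeries.coeff (k - i) W := by
    intro W k
    rw [mul_assoc, PowerSeries.coeff_succ_X_mul, PowerSeries.coeff_mul,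
      Finset.Nat.sum_antidiagonal_eq_sum_range_succ_mk]
    simp
  constructor
  · rintro ⟨h0, h⟩
    ext1 k
    rw [PowerSeries.coeff_mk]
    induction k using Nat.strong_induction_on with
    | _ k ih =>
      cases k with
      | zero => rw [Hs]; simpa using h0
      | succ k =>
        have := congrArg (PowerSeries.coeff (k+1)) h
        rw [coeff_Xd, key] at this
        rw [Hs]
        have e : ∑ i ∈ Finset.range (k+1), q i * Hs q (k - i) =
          ((k : ℚ) + 1) • PowerSeries.coeff (k+1) W := by
          rw [Algebra.smul_def]
          simp only [map_add, map_natCast, map_one]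
          push_cast at this
          rw [this]
          refine Finset.sum_congr rfl fun i hi => ?_
          rw [ih (k - i) (by omega)]
        rw [e, smul_smul, inv_mul_cancel₀ (by positivity), one_smul]
  · rintro rfl
    refine ⟨by simp [Hs_zero], ?_⟩
    ext1 k
    cases k with
    | zero => simp
    | succ k =>
      rw [coeff_Xd, key]
      simp only [PowerSeries.coeff_mk]
      have : (((k + 1 : ℕ) : R)) * Hs q (k+1) = ((k : ℚ) + 1) • Hs q (k+1) := by
        rw [Algebra.smul_def]; simp
      rw [this, Hs, smul_smul, mul_inv_cancel₀ (by positivity), one_smul]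

theorem Hs_geom {R : Type*} [CommRing R] [Algebra ℚ R] (q : ℕ → R) (b : R) (k : ℕ) :
    Hs (fun i => q i + b ^ (i+1)) (k+1) = b * Hs (fun i => q i + b ^ (i+1)) k + Hs q (k+1) := by
  obtain ⟨h0, h1⟩ := (Hs_ser (fun i => q i + b ^ (i+1)) _).2 rfl
  set U := PowerSeries.mk (Hs (fun i => q i + b ^ (i+1))) with hU
  have hg : (1 - PowerSeries.C b * PowerSeries.X) * PowerSeries.mk (fun i => b ^ (i+1)) =
      PowerSeries.C b := by
    ext1 n
    rw [sub_mul, one_mul, mul_assoc, map_sub, PowerSeries.coeff_C_mul]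
    cases n with
    | zero => simp
    | succ n => rw [PowerSeries.coeff_succ_X_mul]; simp [PowerSeries.coeff_C]; ring
  have hs : PowerSeries.mk (fun i => q i + b ^ (i+1)) = PowerSeries.mk q + PowerSeries.mk (fun i => b ^ (i+1)) := by
    ext1 n; simp
  rw [hs] at h1
  have := (Hs_ser q ((1 - PowerSeries.C b * PowerSeries.X) * U)).1 ⟨by simp [h0], by
    rw [Derivation.leibniz, map_sub, Derivation.map_one_eq_zero, Derivation.leibniz,
      PowerSeries.derivative_C, PowerSeries.derivative_X]
    simp only [smul_eq_mul]
    linear_combination (1 - PowerSeries.C b * PowerSeries.X) * h1 + PowerSeries.X * U * hg⟩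
  have := congrArg (PowerSeries.coeff (k+1)) this
  rw [sub_mul, one_mul, mul_assoc, map_sub, PowerSeries.coeff_C_mul, PowerSeries.coeff_succ_X_mul] at this
  simp only [hU, PowerSeries.coeff_mk] at this
  linear_combination this

end PartOne

section PartTwo

/-- adding a variable `t` -/
noncomputable def Dl : SymFn →ₐ[ℚ] Polynomial SymFn :=
  aeval fun m => ∑ a ∈ Finset.range (m + 2), Polynomial.C (hh ((m : ℤ) + 1 - a)) * Polynomial.X ^ a

theorem Dl_hh (n : ℕ) : Dl (hh n) =
    ∑ a ∈ Finset.range (n + 1), Polynomial.C (hh ((n : ℤ) - a)) * Polynomial.X ^ a := by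
  cases n with
  | zero => simp [hh_zero]
  | succ n => push_cast; rw [hh_succ]; simp [Dl]

theorem Dl_step (r : ℤ) :
    Dl (hh (r + 1)) = Polynomial.C (hh (r + 1)) + Polynomial.X * Dl (hh r) := by
  rcases lt_trichotomy r (-1) with h | h | h
  · rw [hh_neg (by omega : r + 1 < 0), hh_neg (by omega : r < 0)]; simp
  · rw [h, hh_neg (by omega : (-1 : ℤ) < 0), show (-1 : ℤ) + 1 = 0 from rfl, hh_zero, map_one, map_zero, map_one, mul_zero, add_zero]
  · obtain ⟨n, rfl⟩ := Int.eq_ofNat_of_zero_le (by omega : 0 ≤ r)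
    have := Dl_hh (n + 1)
    push_cast at this
    rw [this, Dl_hh, Finset.sum_range_succ', Finset.mul_sum, add_comm]
    refine congrArg₂ (· + ·) ?_ ?_
    · simp
    · refine Finset.sum_congr rfl fun i _ => ?_
      rw [show (n : ℤ) + 1 - ((i + 1 : ℕ) : ℤ) = n - i by push_cast; ring]; ring

theorem ser_aux {S : Type*} [CommRing S] [IsDomain S] (t : S) (dH dP cH cP : PowerSeries S)
    (h1 : (1 - PowerSeries.C t * PowerSeries.X) * dH = cH)
    (h2 : dP * dH = PowerSeries.X * PowerSeries.derivative S dH)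
    (h3 : cP * cH = PowerSeries.X * PowerSeries.derivative S cH) (hne : dH ≠ 0) :
    (1 - PowerSeries.C t * PowerSeries.X) * (dP - cP) - PowerSeries.C t * PowerSeries.X = 0 := by
  have h4 : PowerSeries.derivative S cH = (1 - PowerSeries.C t * PowerSeries.X) * PowerSeries.derivative S dH
      - PowerSeries.C t * dH := by
    rw [← h1, Derivation.leibniz, map_sub, Derivation.map_one_eq_zero, Derivation.leibniz,
      PowerSeries.derivative_C, PowerSeries.derivative_X]
    simp only [smul_eq_mul]
    ring
  have h5 : dH * ((1 - PowerSeries.C t * PowerSeries.X) * (dP - cP) - PowerSeries.C t * PowerSeries.X) = 0 := by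
    rw [h4] at h3
    linear_combination (1 - PowerSeries.C t * PowerSeries.X) * h2 - h3 - cP * h1
  exact (mul_eq_zero.1 h5).resolve_left hne

theorem Dl_pp (k : ℕ) : Dl (pp (k+1)) = Polynomial.C (pp (k+1)) + Polynomial.X ^ (k+1) := by
  let S := Polynomial SymFn
  set T : PowerSeries S := PowerSeries.C (Polynomial.X : S) * PowerSeries.X with hT
  set dH := PowerSeries.map Dl.toRingHom Hser with hdH
  set dP := PowerSeries.map Dl.toRingHom Pser with hdP
  set cH := PowerSeries.map (Polynomial.C : SymFn →+* S) Hser with hcH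
  set cP := PowerSeries.map (Polynomial.C : SymFn →+* S) Pser with hcP
  have h1 : (1 - T) * dH = cH := by
    ext1 n
    rw [sub_mul, one_mul, map_sub, hT, mul_assoc, PowerSeries.coeff_C_mul]
    cases n with
    | zero => simp [hdH, hcH, Hser, hh_zero]
    | succ n =>
      rw [PowerSeries.coeff_succ_X_mul]
      simp only [hdH, hcH, Hser, PowerSeries.coeff_map, PowerSeries.coeff_mk]
      have := Dl_step n
      push_cast
      simp only [AlgHom.toRingHom_eq_coe, RingHom.coe_coe]
      rw [this]; ring
  have h2 := congrArg (PowerSeries.map Dl.toRingHom) PH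
  have h3 := congrArg (PowerSeries.map (Polynomial.C : SymFn →+* S)) PH
  rw [map_Xd, map_mul] at h2 h3
  rw [← hdP, ← hdH] at h2
  rw [← hcP, ← hcH] at h3
  have hne : dH ≠ 0 := by
    intro h0
    have := congrArg (PowerSeries.coeff 0) h0
    simp [hdH, Hser, hh_zero] at this
  have h6 := ser_aux (Polynomial.X : S) dH dP cH cP h1 h2 h3 hne
  rw [← hT] at h6
  have hc : ∀ n, PowerSeries.coeff n (dP - cP) = Dl (pp n) - Polynomial.C (pp n) := by
    intro n; simp [hdP, hcP, Pser]
  have h7 : ∀ n, Dl (pp (n+1)) - Polynomial.C (pp (n+1)) =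
      Polynomial.X * (Dl (pp n) - Polynomial.C (pp n)) + if n = 0 then Polynomial.X else 0 := by
    intro n
    have := congrArg (PowerSeries.coeff (n+1)) h6
    rw [sub_mul, one_mul, map_sub, map_sub, hT, mul_assoc, PowerSeries.coeff_C_mul,
      PowerSeries.coeff_succ_X_mul, PowerSeries.coeff_C_mul, hc, hc, PowerSeries.coeff_X] at this
    simp only [map_zero] at this
    by_cases hn : n = 0
    · simp [hn] at this ⊢; linear_combination this
    · simp [hn] at this ⊢; linear_combination this
  rw [← sub_eq_iff_eq_add']
  induction k with
  | zero => rw [h7]; simp [pp]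
  | succ k ih => rw [h7, ih]; simp; ring

/-- the `SymFn`-linear functional on polynomials extracting `t^k` after multiplying by
`∑ (-1)^i e_i t^{-i}` -/
noncomputable def tau (k : ℕ) : Polynomial SymFn →ₗ[SymFn] SymFn :=
  Polynomial.lsum fun a => if k ≤ a then LinearMap.mulRight SymFn ((-1) ^ (a - k) * ee (a - k)) else 0

theorem tau_monomial (k a : ℕ) (c : SymFn) :
    tau k (Polynomial.monomial a c) = if k ≤ a then c * ((-1) ^ (a - k) * ee (a - k)) else 0 := by
  unfold tau
  rw [Polynomial.lsum_apply, Polynomial.sum_monomial_index _ _ (by simp)]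
  split_ifs <;> simp [mul_assoc]

theorem tau_C_mul (k : ℕ) (c : SymFn) (f : Polynomial SymFn) :
    tau k (Polynomial.C c * f) = c * tau k f := by
  rw [Polynomial.C_mul', map_smul, smul_eq_mul]

theorem tau_Dl_hh (k : ℕ) (r : ℤ) : tau k (Dl (hh r)) = if r = k then 1 else 0 := by
  by_cases hr : r < 0
  · rw [hh_neg hr, if_neg (by omega)]; simp
  obtain ⟨n, rfl⟩ := Int.eq_ofNat_of_zero_le (by omega : 0 ≤ r)
  rw [Dl_hh, map_sum]
  simp only [Polynomial.C_mul_X_pow_eq_monomial, tau_monomial]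
  by_cases hk : k ≤ n
  · obtain ⟨d, rfl⟩ := Nat.exists_eq_add_of_le hk
    have h := congrArg (PowerSeries.coeff d) HE
    rw [mul_comm, PowerSeries.coeff_mul, Finset.Nat.sum_antidiagonal_eq_sum_range_succ_mk] at h
    simp only [Hser, Eneg, PowerSeries.coeff_mk, PowerSeries.coeff_one] at h
    rw [show k + d + 1 = k + (d + 1) by ring, Finset.sum_range_add, Finset.sum_eq_zero, zero_add]
    · have e : ((((k + d : ℕ) : ℤ)) = (k : ℤ)) ↔ d = 0 := by push_cast; omega
      simp only [e]
      rw [← h]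
      refine Finset.sum_congr rfl fun i hi => ?_
      have hi' := Finset.mem_range.1 hi
      rw [if_pos (by omega), mul_comm]
      congr 2
      · simp
      · simp
      · push_cast [Nat.cast_sub (by omega : i ≤ d)]; ring
    · intro i hi
      rw [if_neg (by have := Finset.mem_range.1 hi; omega)]
  · rw [if_neg (by omega)]
    refine Finset.sum_eq_zero fun i hi => ?_
    rw [if_neg (by have := Finset.mem_range.1 hi; omega)]

theorem tau_shift (k : ℕ) (f : Polynomial SymFn) : tau (k + 2) (Polynomial.X ^ 2 * f) = tau k f := by
  induction f using Polynomial.induction_on' with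
  | add p q hp hq => rw [mul_add, map_add, hp, hq, map_add]
  | monomial n a =>
    rw [Polynomial.X_pow_mul_monomial, tau_monomial, tau_monomial]
    simp only [add_le_add_iff_right, Nat.add_sub_add_right]

/-- degree bound with integer bound -/
def DegLe (f : Polynomial SymFn) (d : ℤ) : Prop := ∀ a : ℕ, d < a → f.coeff a = 0

theorem tau_DegLe {k : ℕ} {d : ℤ} {f : Polynomial SymFn} (hf : DegLe f d) (h : d < k) :
    tau k f = 0 := by
  rw [f.as_sum_support, map_sum]
  refine Finset.sum_eq_zero fun i hi => ?_
  rw [tau_monomial]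
  split_ifs with hk
  · rw [hf i (by omega), zero_mul]
  · rfl

/-- removing a first row -/
noncomputable def TT (k : ℕ) : SymFn →ₗ[ℚ] SymFn :=
  (tau k).restrictScalars ℚ ∘ₗ Dl.toLinearMap

theorem TT_apply (k : ℕ) (f : SymFn) : TT k f = tau k (Dl f) := rfl

/-- Jacobi-Trudi determinant -/
noncomputable def SS (n : ℕ) (α : Fin n → ℤ) : SymFn :=
  Matrix.det (Matrix.of fun i j : Fin n => hh (α i + (j : ℤ)))

theorem TT_SS (k n : ℕ) (α : Fin (n+1) → ℤ) :
    TT k (SS (n+1) α) = ∑ i : Fin (n+1), if α i = k then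
      (-1) ^ (i : ℕ) * SS n (fun i' => α (i.succAbove i') + 1) else 0 := by
  rw [TT_apply, SS, AlgHom.map_det]
  rw [Matrix.det_eq_of_forall_col_eq_smul_add_pred
    (B := Matrix.of fun i j : Fin (n+1) => Fin.cases (Dl (hh (α i)))
      (fun j' : Fin n => Polynomial.C (hh (α i + (j' + 1 : ℤ)))) j) (fun _ => Polynomial.X)]
  · rw [Matrix.det_succ_column_zero, map_sum]
    refine Finset.sum_congr rfl fun i _ => ?_
    have : (Matrix.det ((Matrix.of fun i j : Fin (n+1) => (Fin.cases (Dl (hh (α i)))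
      (fun j' : Fin n => Polynomial.C (hh (α i + (j' + 1 : ℤ)))) j : Polynomial SymFn)).submatrix i.succAbove Fin.succ))
       = Polynomial.C (SS n (fun i' => α (i.succAbove i') + 1)) := by
      rw [SS, RingHom.map_det]
      congr 1
      ext1 a b
      simp [add_comm, add_left_comm]
    rw [this]
    simp only [Matrix.of_apply, Fin.cases_zero]
    rw [show ((-1 : Polynomial SymFn) ^ (i : ℕ) * Dl (hh (α i)) * Polynomial.C (SS n (fun i' => α (i.succAbove i') + 1)))
      = Polynomial.C ((-1) ^ (i : ℕ) * SS n (fun i' => α (i.succAbove i') + 1)) * Dl (hh (α i)) by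
        simp; ring]
    rw [tau_C_mul, tau_Dl_hh]
    split_ifs <;> simp
  · intro i; simp
  · intro i j
    simp only [AlgHom.mapMatrix_apply, Matrix.map_apply, Matrix.of_apply, Fin.cases_succ, Fin.val_succ,
      Fin.val_castSucc]
    rw [show α i + ((j : ℕ) + 1 : ℤ) = (α i + (j : ℕ)) + 1 by ring, ← Dl_step]
    congr 2
    push_cast; ring

/-- iterated row removal -/
noncomputable def RR : List ℕ → (SymFn →ₗ[ℚ] ℚ)
  | [] => (MvPolynomial.aeval (fun _ => (0 : ℚ)) : SymFn →ₐ[ℚ] ℚ).toLinearMap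
  | k :: l => RR l ∘ₗ TT k

theorem RR_cons (k : ℕ) (l : List ℕ) (f : SymFn) : RR (k :: l) f = RR l (TT k f) := rfl

theorem RR_SS (l : List ℕ) (hl : l.Pairwise (· ≥ ·)) (hpos : ∀ x ∈ l, 0 < x) (n : ℕ) (α : Fin n → ℤ)
    (hα : StrictAnti α) (hα' : ∀ i, 1 < α i + n) :
    RR l (SS n α) = if n = l.length ∧ ∀ i : Fin n, α i = (l.getD i 0 : ℤ) - i then 1 else 0 := by
  induction l generalizing n with
  | nil =>
    cases n with
    | zero => simp [RR, SS]
    | succ n =>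
      simp only [List.length_nil, Nat.succ_ne_zero, false_and, if_false, RR, SS]
      rw [AlgHom.toLinearMap_apply, AlgHom.map_det]
      apply Matrix.det_eq_zero_of_row_eq_zero 0
      intro j
      simp only [AlgHom.mapMatrix_apply, Matrix.map_apply, Matrix.of_apply]
      have h0 : 0 < α 0 := by
        have h1 : ∀ m : ℕ, ∀ hm : m < n + 1, α ⟨m, hm⟩ + m ≤ α 0 := by
          intro m
          induction m with
          | zero => intro hm; simp
          | succ m ih =>
            intro hm
            have := ih (by omega)
            have h2 : α ⟨m+1, hm⟩ < α ⟨m, by omega⟩ := hα (by simp)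
            push_cast; omega
        have := h1 n (by omega)
        have h3 := hα' ⟨n, by omega⟩
        push_cast at h3
        omega
      obtain ⟨r, hr⟩ := Int.eq_ofNat_of_zero_le (by omega : 0 ≤ α 0 + j - 1)
      rw [show α 0 + (j : ℤ) = r + 1 by omega, hh_succ]
      simp
  | cons k l ih =>
    rw [RR_cons]
    cases n with
    | zero =>
      have hk : 0 < k := hpos k (by simp)
      have : SS 0 α = hh (0 : ℕ) := by simp [SS, hh_zero]
      rw [this, TT_apply, tau_Dl_hh, if_neg (by omega)]
      simp
    | succ n =>
      rw [TT_SS, map_sum]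
      rw [List.pairwise_cons] at hl
      have ih' : ∀ i : Fin (n+1), RR l (SS n (fun i' => α (i.succAbove i') + 1)) = _ := fun i =>
        ih hl.2 (fun x hx => hpos x (by simp [hx])) n (fun i' => α (i.succAbove i') + 1)
          (by
            intro a b hab
            have := hα ((Fin.strictMono_succAbove i) hab)
            simp only; omega)
          (by
            intro a
            have := hα' (i.succAbove a)
            push_cast at this; omega)
      rw [Fin.sum_univ_succ, Finset.sum_eq_zero, add_zero]
      · by_cases hk : α 0 = k
        · rw [if_pos hk]
          simp only [Fin.val_zero, pow_zero, one_mul]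
          rw [ih']
          congr 1
          apply propext
          simp only [List.length_cons, Nat.add_right_cancel_iff]
          refine and_congr_right fun _ => ?_
          rw [Fin.forall_fin_succ]
          simp only [hk, Fin.zero_succAbove, Fin.val_zero, List.getD_cons_zero, Fin.val_succ, List.getD_cons_succ]
          constructor
          · intro h
            refine ⟨by simp, fun i => ?_⟩
            have := h i; push_cast; omega
          · rintro ⟨_, h⟩ i
            have := h i; push_cast at this; omega
        · rw [if_neg hk, map_zero, if_neg]
          rintro ⟨_, h⟩
          have := h 0
          simp at this; exact hk this
      · intro i _
        split_ifs with hk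
        · have hn : 0 < n := i.pos
          have : RR l (SS n (fun i' => α ((i.succ).succAbove i') + 1)) = 0 := by
            rw [ih', if_neg]
            rintro ⟨_, h⟩
            have h1 := h ⟨0, hn⟩
            have h2 : (i.succ).succAbove ⟨0, hn⟩ = 0 := by
              rw [Fin.succAbove_of_castSucc_lt]
              · rfl
              · simp [Fin.lt_def]
            rw [h2] at h1
            have h3 : α i.succ < α 0 := hα (Fin.succ_pos i)
            have h4 : l.getD 0 0 ≤ k := by
              cases l with
              | nil => simp
              | cons x l => simpa using hl.1 x (by simp)
            simp only at h1
            push_cast at h1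
            omega
          rcases neg_one_pow_eq_or SymFn ((i.succ : Fin (n+1)) : ℕ) with h | h
          · rw [h, one_mul, this]
          · rw [h, neg_one_mul, map_neg, this, neg_zero]
        · simp

end PartTwo

section PartThree

theorem DegLe.mono {f : Polynomial SymFn} {d e : ℤ} (h : DegLe f d) (hde : d ≤ e) : DegLe f e :=
  fun a ha => h a (by omega)

theorem DegLe.add {f g : Polynomial SymFn} {d : ℤ} (h : DegLe f d) (h' : DegLe g d) :
    DegLe (f + g) d := fun a ha => by rw [Polynomial.coeff_add, h a ha, h' a ha, add_zero]

theorem DegLe.sub {f g : Polynomial SymFn} {d : ℤ} (h : DegLe f d) (h' : DegLe g d) :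
    DegLe (f - g) d := fun a ha => by rw [Polynomial.coeff_sub, h a ha, h' a ha, sub_zero]

theorem DegLe.neg {f : Polynomial SymFn} {d : ℤ} (h : DegLe f d) :
    DegLe (-f) d := fun a ha => by rw [Polynomial.coeff_neg, h a ha, neg_zero]

theorem DegLe.sum {ι : Type*} (s : Finset ι) {f : ι → Polynomial SymFn} {d : ℤ}
    (h : ∀ i ∈ s, DegLe (f i) d) : DegLe (∑ i ∈ s, f i) d := fun a ha => by
  rw [Polynomial.finsetSum_coeff]
  exact Finset.sum_eq_zero fun i hi => h i hi a ha

theorem DegLe.mul {f g : Polynomial SymFn} {d e : ℤ} (h : DegLe f d) (h' : DegLe g e) :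
    DegLe (f * g) (d + e) := fun a ha => by
  rw [Polynomial.coeff_mul]
  refine Finset.sum_eq_zero fun x hx => ?_
  have hx' := Finset.HasAntidiagonal.mem_antidiagonal.1 hx
  by_cases h1 : d < x.1
  · rw [h _ h1, zero_mul]
  · rw [h' x.2 (by omega), mul_zero]

theorem DegLe.smul {f : Polynomial SymFn} {d : ℤ} (c : ℚ) (h : DegLe f d) : DegLe (c • f) d :=
  fun a ha => by rw [Polynomial.coeff_smul, h a ha, smul_zero]

theorem DegLe_zero (d : ℤ) : DegLe 0 d := fun a _ => by simp

theorem DegLe_C (c : SymFn) : DegLe (Polynomial.C c) 0 := fun a ha => by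
  rw [Polynomial.coeff_C, if_neg (by omega)]

theorem DegLe_X_pow (n : ℕ) : DegLe (Polynomial.X ^ n) n := fun a ha => by
  rw [Polynomial.coeff_X_pow, if_neg (by omega)]

theorem DegLe.prod {ι : Type*} (s : Finset ι) {f : ι → Polynomial SymFn} {d : ι → ℤ}
    (h : ∀ i ∈ s, DegLe (f i) (d i)) : DegLe (∏ i ∈ s, f i) (∑ i ∈ s, d i) := by
  classical
  induction s using Finset.induction_on with
  | empty => simpa using DegLe_C 1
  | insert a s ha ih =>
    rw [Finset.prod_insert ha, Finset.sum_insert ha]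
    exact (h a (by simp)).mul (ih fun i hi => h i (by simp [hi]))

theorem DegLe_det {n : ℕ} (M : Matrix (Fin n) (Fin n) (Polynomial SymFn)) (a b : Fin n → ℤ)
    (h : ∀ i j, DegLe (M i j) (a i + b j)) : DegLe M.det (∑ i, a i + ∑ j, b j) := by
  rw [Matrix.det_apply]
  refine DegLe.sum _ fun σ _ => ?_
  have h1 : DegLe (∏ i, M (σ i) i) (∑ i, a i + ∑ j, b j) := by
    have := DegLe.prod Finset.univ (f := fun i => M (σ i) i) (d := fun i => a (σ i) + b i)
      (fun i _ => h _ _)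
    rwa [Finset.sum_add_distrib, Equiv.sum_comp σ a] at this
  rcases Int.units_eq_one_or (Equiv.Perm.sign σ) with hs | hs
  · rw [hs, one_smul]; exact h1
  · rw [hs, Units.neg_smul, one_smul]; exact h1.neg

theorem DegLe_Hs (q : ℕ → Polynomial SymFn) (c : ℤ) (hq : ∀ i, DegLe (q i) (c * (i + 1))) (k : ℕ) :
    DegLe (Hs q k) (c * k) := by
  induction k using Nat.strong_induction_on with
  | _ k ih =>
    cases k with
    | zero => rw [Hs_zero]; simpa using DegLe_C 1
    | succ k =>
      rw [Hs]
      refine DegLe.smul _ (DegLe.sum _ fun i hi => ?_)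
      have hi' := Finset.mem_range.1 hi
      refine ((hq i).mul (ih (k - i) (by omega))).mono (le_of_eq ?_)
      push_cast [Nat.cast_sub (by omega : i ≤ k)]; ring

/-- plethysm as an algebra map -/
noncomputable def PL (g : SymFn) : SymFn →ₐ[ℚ] SymFn := aeval (fun m => hPleth g (m+1))

theorem pleth_eq (f g : SymFn) : pleth f g = PL g f := rfl

theorem PL_hh (g : SymFn) (n : ℕ) : PL g (hh n) = hPleth g n := by
  cases n with
  | zero => simp [hh_zero, hPleth]
  | succ n => push_cast; rw [hh_succ]; simp [PL]

noncomputable def qh (i : ℕ) : Polynomial SymFn :=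
  Polynomial.C ((2 : ℚ)⁻¹ • (pp (i+1) * pp (i+1) + pp (2 * (i+1)))) +
    Polynomial.C (pp (i+1)) * Polynomial.X ^ (i+1)

noncomputable def qe (i : ℕ) : Polynomial SymFn :=
  Polynomial.C ((2 : ℚ)⁻¹ • (pp (i+1) * pp (i+1) - pp (2 * (i+1)))) +
    Polynomial.C (pp (i+1)) * Polynomial.X ^ (i+1)

theorem half_smul_C (a : SymFn) :
    Polynomial.C ((2 : ℚ)⁻¹ • a) = (2 : ℚ)⁻¹ • (Polynomial.C a : Polynomial SymFn) := by
  rw [Polynomial.smul_C]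

theorem two_half (a : Polynomial SymFn) : a = (2 : ℚ)⁻¹ • (2 * a) := by
  rw [two_mul, ← two_smul ℚ, smul_smul]; norm_num

theorem Dl_adams_h2 (i : ℕ) :
    Dl (adams (i+1) (hh 2)) = qh i + (Polynomial.X ^ 2) ^ (i+1) := by
  rw [adams_h2, map_smul, map_add, map_mul, Dl_pp, show 2 * (i+1) = (2 * i + 1) + 1 by ring, Dl_pp]
  rw [qh, half_smul_C, add_assoc ((2 : ℚ)⁻¹ • _),
    two_half (Polynomial.C (pp (i+1)) * Polynomial.X ^ (i+1) + (Polynomial.X ^ 2) ^ (i+1)), ← smul_add]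
  congr 1
  rw [map_add, map_mul, show 2 * (i+1) = (2 * i + 1) + 1 by ring]
  ring

theorem Dl_adams_e2 (i : ℕ) : Dl (adams (i+1) (ee 2)) = qe i := by
  rw [adams_e2, map_smul, map_sub, map_mul, Dl_pp, show 2 * (i+1) = (2 * i + 1) + 1 by ring, Dl_pp]
  rw [qe, half_smul_C,
    two_half (Polynomial.C (pp (i+1)) * Polynomial.X ^ (i+1)), ← smul_add]
  congr 1
  rw [map_sub, map_mul, show 2 * (i+1) = (2 * i + 1) + 1 by ring]
  ring

theorem DegLe_q (i : ℕ) (c d : SymFn) :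
    DegLe (Polynomial.C c + Polynomial.C d * Polynomial.X ^ (i+1)) (1 * (i + 1)) := by
  refine DegLe.add ((DegLe_C _).mono (by positivity)) ?_
  refine ((DegLe_C d).mul (DegLe_X_pow (i+1))).mono (by push_cast; omega)

noncomputable def AA (q : ℕ → Polynomial SymFn) (r : ℤ) : Polynomial SymFn :=
  if r < 0 then 0 else Hs q r.toNat

theorem DegLe_AA (q : ℕ → Polynomial SymFn) (hq : ∀ i : ℕ, DegLe (q i) (1 * (i + 1))) (r : ℤ) :
    DegLe (AA q r) r := by
  unfold AA
  split_ifs with h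
  · exact DegLe_zero _
  · refine (DegLe_Hs q 1 hq _).mono (by omega)

noncomputable def BB (r : ℤ) : Polynomial SymFn := Dl (PL (hh 2) (hh r))

theorem BB_neg {r : ℤ} (h : r < 0) : BB r = 0 := by rw [BB, hh_neg h, map_zero, map_zero]

theorem BB_nat (n : ℕ) : BB n = Hs (fun i => qh i + (Polynomial.X ^ 2) ^ (i+1)) n := by
  rw [BB, PL_hh, hPleth_eq, map_Hs]
  simp only [Dl_adams_h2]

theorem DegLe_BB (r : ℤ) : DegLe (BB r) (2 * r) := by
  by_cases h : r < 0
  · rw [BB_neg h]; exact DegLe_zero _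
  · obtain ⟨n, rfl⟩ := Int.eq_ofNat_of_zero_le (by omega : 0 ≤ r)
    rw [BB_nat]
    refine DegLe_Hs _ 2 (fun i => ?_) n
    refine DegLe.add ((DegLe_q i _ _).mono (by omega)) ?_
    rw [← pow_mul]
    exact (DegLe_X_pow _).mono (by push_cast; omega)

theorem BB_step (r : ℤ) : BB (r + 1) = AA qh (r + 1) + Polynomial.X ^ 2 * BB r := by
  by_cases h : r < -1
  · rw [BB_neg (by omega), BB_neg (by omega), AA, if_pos (by omega), mul_zero, add_zero]
  by_cases h' : r = -1
  · subst h'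
    rw [BB_neg (by omega : (-1 : ℤ) < 0), show (-1 : ℤ) + 1 = ((0 : ℕ) : ℤ) from rfl, BB_nat, AA,
      if_neg (by omega), Int.toNat_natCast, Hs_zero, Hs_zero, mul_zero, add_zero]
  · obtain ⟨n, rfl⟩ := Int.eq_ofNat_of_zero_le (by omega : 0 ≤ r)
    rw [AA, if_neg (by omega), BB_nat, show ((n : ℤ) + 1) = ((n + 1 : ℕ) : ℤ) by push_cast; rfl,
      BB_nat, Int.toNat_natCast, Hs_geom, add_comm]

theorem EE_eq (r : ℤ) : Dl (PL (ee 2) (hh r)) = AA qe r := by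
  rw [AA]
  split_ifs with h
  · rw [hh_neg h, map_zero, map_zero]
  · obtain ⟨n, rfl⟩ := Int.eq_ofNat_of_zero_le (by omega : 0 ≤ r)
    rw [PL_hh, hPleth_eq, map_Hs, Int.toNat_natCast]
    simp only [Dl_adams_e2]

/-- Jacobi-Trudi matrix with entries `BB` and first row `k` -/
noncomputable def MM (n : ℕ) (l : Fin n → ℤ) (k : ℤ) :
    Matrix (Fin (n+1)) (Fin (n+1)) (Polynomial SymFn) :=
  Matrix.of fun i j => BB ((Fin.cons k l : Fin (n+1) → ℤ) i + (j : ℤ) - (i : ℤ))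

theorem MM_diff (n : ℕ) (l : Fin n → ℤ) (k L : ℤ) (hL : 0 ≤ L) (hl : ∀ i : Fin n, l i - (i + 1) ≤ L) :
    DegLe ((MM n l (k+1)).det - Polynomial.X ^ 2 * (MM n l k).det) (k + 2 + ∑ i, l i + L) := by
  set v : Fin (n+1) → Polynomial SymFn := fun j => AA qh (k + 1 + j) with hv
  have e1 : MM n l (k+1) = (MM n l k).updateRow 0 (v + (Polynomial.X ^ 2 : Polynomial SymFn) • (MM n l k 0)) := by
    ext1 i j
    refine Fin.cases ?_ (fun i => ?_) i
    · rw [Matrix.updateRow_self]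
      simp only [MM, Matrix.of_apply, Fin.cons_zero, hv, Pi.add_apply, Pi.smul_apply, smul_eq_mul,
        Fin.val_zero]
      have := BB_step (k + j)
      push_cast
      rw [sub_zero, sub_zero, show k + 1 + (j : ℤ) = k + j + 1 by ring, this]
    · rw [Matrix.updateRow_ne (Fin.succ_ne_zero i)]
      simp [MM]
  have e2 : (MM n l (k+1)).det - Polynomial.X ^ 2 * (MM n l k).det = ((MM n l k).updateRow 0 v).det := by
    rw [e1, Matrix.det_updateRow_add, Matrix.det_updateRow_smul, Matrix.updateRow_eq_self]
    ring
  rw [e2]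
  set N := (MM n l k).updateRow 0 v with hN
  have hN0 : ∀ j, N 0 j = AA qh (k + 1 + j) := fun j => by rw [hN, Matrix.updateRow_self]
  have hN1 : ∀ (i : Fin n) j, N i.succ j = BB (l i + j - (i + 1)) := fun i j => by
    rw [hN, Matrix.updateRow_ne (Fin.succ_ne_zero i)]; simp [MM]
  rw [Matrix.det_eq_of_forall_col_eq_smul_add_pred
    (B := Matrix.of fun i j : Fin (n+1) => Fin.cases (N i 0)
      (fun j' : Fin n => N i j'.succ - Polynomial.X ^ 2 * N i j'.castSucc) j)
      (fun _ => Polynomial.X ^ 2)]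
  · have hA := DegLe_AA qh (fun i => DegLe_q i _ _)
    have := DegLe_det (Matrix.of fun i j : Fin (n+1) => (Fin.cases (N i 0)
      (fun j' : Fin n => N i j'.succ - Polynomial.X ^ 2 * N i j'.castSucc) j : Polynomial SymFn))
      (Fin.cons (k + 2) (fun i : Fin n => l i - (i + 1)))
      (Fin.cons L (fun j : Fin n => (j : ℤ) + 1)) (by
        intro i j
        refine Fin.cases ?_ (fun i => ?_) i
        · refine Fin.cases ?_ (fun j => ?_) j
          · simp only [Matrix.of_apply, Fin.cases_zero, Fin.cons_zero, hN0]
            exact (hA _).mono (by simp; omega)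
          · simp only [Matrix.of_apply, Fin.cases_succ, Fin.cons_zero, Fin.cons_succ, hN0]
            refine DegLe.sub ((hA _).mono (by simp only [Fin.val_succ]; push_cast; omega)) ?_
            refine ((DegLe_X_pow 2).mul (hA _)).mono ?_
            simp only [Fin.val_castSucc]; push_cast; omega
        · refine Fin.cases ?_ (fun j => ?_) j
          · simp only [Matrix.of_apply, Fin.cases_zero, Fin.cons_succ, Fin.cons_zero, hN1]
            have := hl i
            exact (DegLe_BB _).mono (by simp; omega)
          · simp only [Matrix.of_apply, Fin.cases_succ, Fin.cons_succ, hN1]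
            rw [show l i + ((j.succ : Fin (n+1)) : ℕ) - ((i : ℕ) + 1 : ℤ) = (l i + ((j.castSucc : Fin (n+1)) : ℕ) - (i + 1)) + 1 by
              simp; ring, BB_step, add_sub_cancel_right]
            exact (hA _).mono (by simp; omega))
    refine this.mono (le_of_eq ?_)
    simp only [Fin.sum_univ_succ, Fin.cons_zero, Fin.cons_succ, Finset.sum_sub_distrib]
    ring
  · intro i; simp
  · intro i j; simp

end PartThree

section PartFour

theorem tau_sum_form (N p q : ℕ) (hp : p < N) :
    ∑ s : Fin N, hh ((p : ℤ) - (s : ℕ)) * ((-1) ^ ((s : ℕ) + q) * om (hh (((s : ℕ) : ℤ) - q))) =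
      if p = q then 1 else 0 := by
  have h := tau_Dl_hh q p
  rw [Dl_hh, map_sum] at h
  simp only [Polynomial.C_mul_X_pow_eq_monomial, tau_monomial, Nat.cast_inj] at h
  rw [← h, Finset.sum_range (n := p + 1)] 
  rw [← Finset.sum_range (n := p + 1) (fun i : ℕ => if q ≤ i then hh ((p : ℤ) - i) * ((-1) ^ (i - q) * ee (i - q)) else 0)]
  rw [← Finset.sum_range (n := N) (fun s : ℕ => hh ((p : ℤ) - s) * ((-1) ^ (s + q) * om (hh ((s : ℤ) - q))))]
  symm
  apply Finset.sum_subset_zero_on_sdiff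
  · intro x hx; simp only [Finset.mem_range] at *; omega
  · intro x hx
    simp only [Finset.mem_sdiff, Finset.mem_range] at hx
    rw [hh_neg (by omega), zero_mul]
  · intro x hx
    split_ifs with hq
    · obtain ⟨d, rfl⟩ := Nat.exists_eq_add_of_le hq
      rw [show (((q + d : ℕ) : ℤ) - q) = (d : ℕ) by push_cast; ring, om_hh, Nat.add_sub_cancel_left]
      rw [show q + d + q = d + 2 * q by ring, pow_add, pow_mul]
      simp
    · rw [om_hh_neg (by omega)]; simp

theorem sign_shuffle (n m : ℕ) (a : Fin n → ℕ) (b : Fin m → ℕ) (ha : Antitone a) (hb : Antitone b)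
    (hb' : ∀ j, b j ≤ n)
    (hab : ∀ (i : Fin n) (j : Fin m), (j : ℕ) < a i ↔ (i : ℕ) < b j) (σ : Equiv.Perm (Fin (n + m)))
    (h1 : ∀ i : Fin n, (σ (Fin.castAdd m i) : ℕ) = a i.rev + i)
    (h2 : ∀ j : Fin m, (σ (Fin.natAdd n j) : ℕ) = n + j - b j) :
    Equiv.Perm.sign σ = ∏ j, (-1) ^ (b j) := by
  rw [Equiv.Perm.sign_eq_prod_prod_Ioi]
  have e : ∀ i : Fin (n+m), ∏ j ∈ Finset.Ioi i, (if σ i < σ j then (1 : ℤˣ) else -1) =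
      ∏ j, if i < j then (if σ i < σ j then (1 : ℤˣ) else -1) else 1 := by
    intro i
    rw [← Finset.prod_filter, Finset.filter_lt_eq_Ioi]
  simp only [e]
  rw [Fin.prod_univ_add]
  simp only [Fin.prod_univ_add]
  have hA : ∀ i i' : Fin n, (if Fin.castAdd m i < Fin.castAdd m i' then
      (if σ (Fin.castAdd m i) < σ (Fin.castAdd m i') then (1 : ℤˣ) else -1) else 1) = 1 := by
    intro i i'
    split_ifs with h h'
    · rfl
    · exfalso; apply h'
      rw [Fin.lt_def, h1, h1]
      rw [Fin.lt_def] at h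
      simp only [Fin.val_castAdd] at h
      have := ha (show i'.rev ≤ i.rev by rw [Fin.rev_le_rev, Fin.le_def]; omega)
      omega
    · rfl
  have hB : ∀ i i' : Fin m, (if Fin.natAdd n i < Fin.natAdd n i' then
      (if σ (Fin.natAdd n i) < σ (Fin.natAdd n i') then (1 : ℤˣ) else -1) else 1) = 1 := by
    intro i i'
    split_ifs with h h'
    · rfl
    · exfalso; apply h'
      rw [Fin.lt_def, h2, h2]
      rw [Fin.lt_def] at h
      simp only [Fin.val_natAdd] at h
      have := hb (show i ≤ i' by rw [Fin.le_def]; omega)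
      have := hb' i; have := hb' i'
      omega
    · rfl
  have hC : ∀ (j : Fin m) (i : Fin n), (if Fin.natAdd n j < Fin.castAdd m i then
      (if σ (Fin.natAdd n j) < σ (Fin.castAdd m i) then (1 : ℤˣ) else -1) else 1) = 1 := by
    intro j i
    rw [if_neg]
    rw [Fin.lt_def]; simp only [Fin.val_natAdd, Fin.val_castAdd]; omega
  have hD : ∀ (i : Fin n) (j : Fin m), (if Fin.castAdd m i < Fin.natAdd n j then
      (if σ (Fin.castAdd m i) < σ (Fin.natAdd n j) then (1 : ℤˣ) else -1) else 1) =
        if (i.rev : ℕ) < b j then -1 else 1 := by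
    intro i j
    rw [if_pos (by rw [Fin.lt_def]; simp only [Fin.val_natAdd, Fin.val_castAdd]; omega)]
    have h3 := hab i.rev j
    have h4 : (σ (Fin.castAdd m i) < σ (Fin.natAdd n j)) ↔ ¬ ((i.rev : ℕ) < b j) := by
      rw [Fin.lt_def, h1, h2]
      have := hb' j
      have h5 := Fin.val_rev i
      have := i.2
      constructor
      · intro h h'
        have := h3.2 h'
        omega
      · intro h
        have : ¬ ((j : ℕ) < a i.rev) := fun h' => h (h3.1 h')
        omega
    simp only [h4, ite_not]
  simp only [hA, hB, hC, hD, Finset.prod_const_one, one_mul, mul_one]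
  rw [Finset.prod_comm]
  refine Finset.prod_congr rfl fun j _ => ?_
  rw [← Equiv.prod_comp Fin.revPerm]
  simp only [Fin.revPerm_apply, Fin.rev_rev]
  rw [← Finset.prod_range (n := n) (fun i => if i < b j then (-1 : ℤˣ) else 1), ← Finset.prod_filter]
  rw [Finset.prod_const]
  congr 1
  rw [show (Finset.range n).filter (· < b j) = Finset.range (b j) by
    ext x; simp only [Finset.mem_filter, Finset.mem_range]; have := hb' j; omega]
  simp

theorem block_minor {R : Type*} [CommRing R] {n m : ℕ}
    (A B : Matrix (Fin n ⊕ Fin m) (Fin n ⊕ Fin m) R) (h : A * B = 1) :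
    A.toBlocks₁₁.det = A.det * B.toBlocks₂₂.det := by
  have h' : Matrix.fromBlocks A.toBlocks₁₁ A.toBlocks₁₂ A.toBlocks₂₁ A.toBlocks₂₂ *
    Matrix.fromBlocks B.toBlocks₁₁ B.toBlocks₁₂ B.toBlocks₂₁ B.toBlocks₂₂ = 1 := by
    rw [Matrix.fromBlocks_toBlocks, Matrix.fromBlocks_toBlocks, h]
  rw [Matrix.fromBlocks_multiply, ← Matrix.fromBlocks_one, Matrix.fromBlocks_inj] at h'
  have e : A * Matrix.fromBlocks 1 B.toBlocks₁₂ 0 B.toBlocks₂₂ =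
      Matrix.fromBlocks A.toBlocks₁₁ 0 A.toBlocks₂₁ 1 := by
    conv_lhs => rw [← Matrix.fromBlocks_toBlocks A]
    rw [Matrix.fromBlocks_multiply]
    rw [h'.2.1, h'.2.2.2]
    simp
  have := congrArg Matrix.det e
  rw [Matrix.det_mul, Matrix.det_fromBlocks_zero₂₁, Matrix.det_fromBlocks_zero₁₂] at this
  simpa using this.symm

theorem dual_JT (n m : ℕ) (a : Fin n → ℕ) (b : Fin m → ℕ) (ha : Antitone a) (hb : Antitone b)
    (ha' : ∀ i, a i ≤ m) (hb' : ∀ j, b j ≤ n)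
    (hab : ∀ (i : Fin n) (j : Fin m), (j : ℕ) < a i ↔ (i : ℕ) < b j) :
    SS n (fun i => (a i : ℤ) - i) = om (SS m (fun j => (b j : ℤ) - j)) := by
  classical
  let r : Fin (n + m) → Fin (n + m) := Fin.addCases
    (fun i => ⟨a i.rev + i, by have := ha' i.rev; have := i.2; omega⟩)
    (fun j => ⟨n + j - b j, by have := j.2; omega⟩)
  have r1 : ∀ i, (r (Fin.castAdd m i) : ℕ) = a i.rev + i := fun i => by simp [r]
  have r2 : ∀ j, (r (Fin.natAdd n j) : ℕ) = n + j - b j := fun j => by simp [r]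
  have rinj : Function.Injective r := by
    have cross : ∀ i j, r (Fin.castAdd m i) ≠ r (Fin.natAdd n j) := by
      intro i j h
      have h := congrArg Fin.val h
      rw [r1, r2] at h
      have := hb' j
      have h5 := Fin.val_rev i
      have := i.2
      have h3 := hab i.rev j
      by_cases hc : (j : ℕ) < a i.rev
      · have := h3.1 hc; omega
      · have : ¬ ((i.rev : ℕ) < b j) := fun h => hc (h3.2 h)
        omega
    intro x y
    refine Fin.addCases (fun i => ?_) (fun j => ?_) x <;>
      refine Fin.addCases (fun i' => ?_) (fun j' => ?_) y
    · intro h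
      have h := congrArg Fin.val h
      rw [r1, r1] at h
      have : i = i' := by
        rcases le_total i i' with hh | hh
        · have := ha (Fin.rev_le_rev.2 hh)
          have hh' := Fin.le_def.1 hh
          exact Fin.ext (by omega)
        · have := ha (Fin.rev_le_rev.2 hh)
          have hh' := Fin.le_def.1 hh
          exact Fin.ext (by omega)
      rw [this]
    · intro h; exact absurd h (cross _ _)
    · intro h; exact absurd h.symm (cross _ _)
    · intro h
      have h := congrArg Fin.val h
      rw [r2, r2] at h
      have h6 := hb' j
      have h7 := hb' j'
      have : j = j' := by
        rcases le_total j j' with hh | hh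
        · have := hb hh
          have hh' := Fin.le_def.1 hh
          exact Fin.ext (by omega)
        · have := hb hh
          have hh' := Fin.le_def.1 hh
          exact Fin.ext (by omega)
      rw [this]
  let σ : Equiv.Perm (Fin (n+m)) := Equiv.ofBijective r (Finite.injective_iff_bijective.1 rinj)
  have hσ : ∀ x, σ x = r x := fun x => rfl
  have hs := sign_shuffle n m a b ha hb hb' hab σ r1 r2
  let M : Matrix (Fin (n+m)) (Fin (n+m)) SymFn := Matrix.of fun p q => hh (((p : ℕ) : ℤ) - (q : ℕ))
  let E : Matrix (Fin (n+m)) (Fin (n+m)) SymFn := Matrix.of fun p q =>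
    (-1) ^ ((p : ℕ) + (q : ℕ)) * om (hh (((p : ℕ) : ℤ) - (q : ℕ)))
  have hME : M * E = 1 := by
    ext1 p q
    rw [Matrix.mul_apply, Matrix.one_apply]
    simp only [M, E, Matrix.of_apply]
    rw [tau_sum_form (n+m) p q p.2]
    simp only [Fin.ext_iff]
  have hM : M.det = 1 := by
    rw [Matrix.det_of_isLowerTriangular M]
    · simp [M, hh_zero]
    · intro p q hpq
      simp only [M, Matrix.of_apply]
      have : (p : ℕ) < q := hpq
      exact hh_neg (by omega)
  let f : Fin n ⊕ Fin m ≃ Fin (n + m) := finSumFinEquiv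
  have hAB : (M.submatrix (σ ∘ f) f) * (E.submatrix f (σ ∘ f)) = 1 := by
    rw [Matrix.submatrix_mul_equiv, hME]
    exact Matrix.submatrix_one_equiv (f.trans σ)
  have key := block_minor _ _ hAB
  have hdA : (M.submatrix (σ ∘ f) f).det = ((Equiv.Perm.sign σ : ℤˣ) : ℤ) := by
    have : M.submatrix (σ ∘ f) f = (M.submatrix σ id).submatrix f f := rfl
    rw [this, Matrix.det_submatrix_equiv_self, Matrix.det_permute, hM, mul_one]
  have hA11 : (M.submatrix (σ ∘ f) f).toBlocks₁₁.det = SS n (fun i => (a i : ℤ) - i) := by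
    rw [← Matrix.det_submatrix_equiv_self Fin.revPerm, SS]
    congr 1
    ext1 i j
    simp only [Matrix.submatrix_apply, Matrix.toBlocks₁₁, Matrix.of_apply, Function.comp, f, M,
      finSumFinEquiv_apply_left, hσ, r1, Fin.revPerm_apply, Fin.rev_rev, Fin.val_castAdd]
    rw [Fin.val_rev, Fin.val_rev]
    have := i.2; have := j.2
    congr 1
    omega
  have hB22 : (E.submatrix f (σ ∘ f)).toBlocks₂₂.det = (∏ j, (-1) ^ (b j)) * om (SS m (fun j => (b j : ℤ) - j)) := by
    have e1 : (E.submatrix f (σ ∘ f)).toBlocks₂₂ = Matrix.of fun i j : Fin m => (-1 : SymFn) ^ (i : ℕ) *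
        (Matrix.of fun i j : Fin m => (-1 : SymFn) ^ ((j : ℕ) + b j) * (om.mapMatrix (Matrix.of fun i j : Fin m =>
          hh (((b i : ℤ) - i) + (j : ℤ)))).transpose i j) i j := by
      ext1 i j
      simp only [Matrix.submatrix_apply, Matrix.toBlocks₂₂, Matrix.of_apply, Function.comp, f, E,
        finSumFinEquiv_apply_right, hσ, r2, Fin.val_natAdd, Matrix.transpose_apply, AlgHom.mapMatrix_apply,
        Matrix.map_apply]
      have h6 := hb' j
      rw [← mul_assoc, ← pow_add]
      congr 1
      · obtain ⟨d, hd⟩ := Nat.exists_eq_add_of_le h6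
        rw [show n + j - b j = d + j by omega, hd,
          show b j + d + ↑i + (d + ↑j) = (↑i + (↑j + b j)) + 2 * d by ring, pow_add _ _ (2 * d), pow_mul]
        simp
      · congr 2
        omega
    rw [e1, Matrix.det_mul_column, Matrix.det_mul_row, Matrix.det_transpose, ← AlgHom.map_det, ← SS,
      ← mul_assoc, ← Finset.prod_mul_distrib]
    congr 1
    refine Finset.prod_congr rfl fun j _ => ?_
    rw [← pow_add, show (j : ℕ) + (j + b j) = b j + 2 * j by ring, pow_add, pow_mul]
    simp
  rw [hA11, hdA, hB22, hs, ← mul_assoc] at key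
  rw [key]
  push_cast
  rw [← Finset.prod_mul_distrib, Finset.prod_eq_one, one_mul]
  intro j _
  rw [← mul_pow]; simp

end PartFour
section PartFive

theorem sp_coe (m : Multiset ℕ) : ((sortedParts m : List ℕ) : Multiset ℕ) = m := by
  rw [sortedParts, Multiset.coe_reverse, Multiset.sort_eq]

theorem sp_length (m : Multiset ℕ) : (sortedParts m).length = Multiset.card m := by
  rw [← Multiset.coe_card, sp_coe]

theorem sp_mem (m : Multiset ℕ) (x : ℕ) : x ∈ sortedParts m ↔ x ∈ m := by
  rw [← Multiset.mem_coe, sp_coe]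

theorem sp_pair (m : Multiset ℕ) : (sortedParts m).Pairwise (· ≥ ·) := by
  rw [sortedParts, List.pairwise_reverse]
  exact Multiset.pairwise_sort m (· ≤ ·)

theorem sp_unique (m : Multiset ℕ) (l : List ℕ) (hl : l.Pairwise (· ≥ ·)) (h : (l : Multiset ℕ) = m) :
    sortedParts m = l := by
  have hp : (sortedParts m).Perm l := by
    rw [← Multiset.coe_eq_coe, sp_coe, h]
  exact hp.eq_of_pairwise (le := (· ≥ ·)) (fun a b _ _ h1 h2 => le_antisymm h2 h1) (sp_pair m) hl

theorem sp_cons (m : Multiset ℕ) (k : ℕ) (h : ∀ x ∈ m, x ≤ k) :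
    sortedParts (k ::ₘ m) = k :: sortedParts m := by
  apply sp_unique
  · rw [List.pairwise_cons]
    exact ⟨fun x hx => h x ((sp_mem m x).1 hx), sp_pair m⟩
  · rw [← Multiset.cons_coe, sp_coe]

/-- the `i`-th part -/
def pt (m : Multiset ℕ) (i : ℕ) : ℕ := (sortedParts m).getD i 0

theorem list_galois (l : List ℕ) (hl : l.Pairwise (· ≥ ·)) (i j : ℕ) :
    j < l.getD i 0 ↔ i < (l.filter (fun x => j < x)).length := by
  induction l generalizing i with
  | nil => simp
  | cons x l ih =>
    rw [List.pairwise_cons] at hl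
    by_cases hx : j < x
    · rw [List.filter_cons_of_pos (by simpa using hx)]
      cases i with
      | zero => simpa using hx
      | succ i => simpa using ih hl.2 i
    · have he : (l.filter (fun x => j < x)) = [] := by
        rw [List.filter_eq_nil_iff]
        intro y hy
        have := hl.1 y hy
        simp only [decide_eq_true_eq]; omega
      rw [List.filter_cons_of_neg (by simpa using hx), he]
      cases i with
      | zero => simpa using hx
      | succ i =>
        have := ih hl.2 i
        rw [he] at this
        simpa using this

theorem pt_galois (m : Multiset ℕ) (i j : ℕ) :
    j < pt m i ↔ i < Multiset.card (m.filter (fun x => j < x)) := by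
  rw [pt, list_galois _ (sp_pair m)]
  conv_rhs => rw [← sp_coe m]
  rw [Multiset.filter_coe, Multiset.coe_card]

theorem conj_list_pair (m : Multiset ℕ) :
    ((List.range m.sup).map fun i => Multiset.card (m.filter fun x => i < x)).Pairwise (· ≥ ·) := by
  rw [List.pairwise_map]
  refine List.Pairwise.imp ?_ (List.pairwise_lt_range)
  intro a b hab
  apply Multiset.card_le_card
  apply Multiset.monotone_filter_right
  intro x hx
  omega

theorem sp_conj (m : Multiset ℕ) : sortedParts (conj m) =
    (List.range m.sup).map fun i => Multiset.card (m.filter fun x => i < x) :=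
  sp_unique _ _ (conj_list_pair m) rfl

theorem card_conj (m : Multiset ℕ) : Multiset.card (conj m) = m.sup := by
  simp [conj]

theorem pt_conj (m : Multiset ℕ) (j : ℕ) :
    pt (conj m) j = Multiset.card (m.filter (fun x => j < x)) := by
  rw [pt, sp_conj]
  by_cases h : j < m.sup
  · rw [List.getD_eq_getElem _ _ (by simpa using h)]
    simp
  · rw [List.getD_eq_default _ _ (by simpa using h), eq_comm, Multiset.card_eq_zero,
      Multiset.filter_eq_nil]
    intro x hx
    have := Multiset.le_sup hx
    omega

theorem pt_conj_galois (m : Multiset ℕ) (i j : ℕ) : j < pt m i ↔ i < pt (conj m) j := by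
  rw [pt_conj, pt_galois]

theorem conj_part (m : Multiset ℕ) : IsPartition (conj m) := by
  intro h
  rw [conj, Multiset.mem_coe, List.mem_map] at h
  obtain ⟨i, hi, h⟩ := h
  rw [List.mem_range] at hi
  rw [Multiset.card_eq_zero, Multiset.filter_eq_nil] at h
  have : m.sup ≤ i := Multiset.sup_le.2 fun x hx => not_lt.1 (h x hx)
  omega

theorem pt_pos (m : Multiset ℕ) (hm : IsPartition m) (i : ℕ) : 0 < pt m i ↔ i < Multiset.card m := by
  rw [pt_galois]
  rw [Multiset.filter_eq_self.2]
  intro x hx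
  rcases Nat.eq_zero_or_pos x with h | h
  · subst h; exact absurd hx hm
  · exact h

theorem pt_inj (m m' : Multiset ℕ) (hm : IsPartition m) (hm' : IsPartition m')
    (h : ∀ i, pt m i = pt m' i) : m = m' := by
  have hc : Multiset.card m = Multiset.card m' := by
    apply le_antisymm
    · by_contra hh
      have h1 := (pt_pos m hm (Multiset.card m')).2 (by omega)
      rw [h, pt_pos m' hm'] at h1; omega
    · by_contra hh
      have h1 := (pt_pos m' hm' (Multiset.card m)).2 (by omega)
      rw [← h, pt_pos m hm] at h1; omega
  rw [← sp_coe m, ← sp_coe m']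
  congr 1
  apply List.ext_getElem
  · rw [sp_length, sp_length, hc]
  · intro i h1 h2
    have := h i
    rwa [pt, pt, List.getD_eq_getElem _ _ h1, List.getD_eq_getElem _ _ h2] at this

theorem conj_conj (m : Multiset ℕ) (hm : IsPartition m) : conj (conj m) = m := by
  apply pt_inj _ _ (conj_part _) hm
  intro i
  have h : ∀ j, j < pt (conj (conj m)) i ↔ j < pt m i := fun j => by
    rw [← pt_conj_galois (conj m) j i, ← pt_conj_galois]
  apply le_antisymm
  · by_contra hh
    have := (h (pt m i)).1 (by omega); omega
  · by_contra hh
    have := (h (pt (conj (conj m)) i)).2 (by omega); omega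

theorem pt_anti (m : Multiset ℕ) : Antitone (pt m) := by
  intro i i' h
  by_contra hh
  have h1 : pt m i < pt m i' := by omega
  rw [pt_galois] at h1
  have h2 := (pt_galois m i (pt m i)).2 (by omega)
  omega

theorem pt_le_sup (m : Multiset ℕ) (i : ℕ) : pt m i ≤ m.sup := by
  rw [pt]
  by_cases h : i < (sortedParts m).length
  · rw [List.getD_eq_getElem _ _ h]
    exact Multiset.le_sup ((sp_mem m _).1 (List.getElem_mem h))
  · rw [List.getD_eq_default _ _ (by omega)]; exact Nat.zero_le _

theorem schur_SS (m : Multiset ℕ) :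
    schur m = SS (Multiset.card m) (fun i => (pt m i : ℤ) - (i : ℕ)) := by
  rw [schur, SS]
  congr 1
  ext1 i j
  simp only [Matrix.of_apply, pt]
  congr 1
  ring

theorem om_schur (m : Multiset ℕ) : om (schur m) = schur (conj m) := by
  rw [schur_SS, schur_SS, card_conj]
  refine (dual_JT m.sup (Multiset.card m) (fun i => pt (conj m) i) (fun j => pt m j) ?_ ?_ ?_ ?_ ?_).symm
  · intro i i' h; exact pt_anti _ h
  · intro i i' h; exact pt_anti _ h
  · intro i
    rw [pt_conj]; exact Multiset.card_le_card (Multiset.filter_le _ _)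
  · intro j; exact pt_le_sup m j
  · intro i j
    exact (pt_conj_galois m j i).symm

theorem RR_schur (k m : Multiset ℕ) (hk : IsPartition k) (hm : IsPartition m) :
    RR (sortedParts k) (schur m) = if m = k then 1 else 0 := by
  rw [schur_SS, RR_SS _ (sp_pair k)]
  · rw [sp_length]
    refine if_congr ?_ rfl rfl
    constructor
    · rintro ⟨h1, h2⟩
      apply pt_inj _ _ hm hk
      intro i
      by_cases hi : i < Multiset.card m
      · have := h2 ⟨i, hi⟩
        change (pt m i : ℤ) - i = (pt k i : ℤ) - i at this
        exact_mod_cast (sub_left_inj.1 this)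
      · have a1 := (pt_pos m hm i).not.2 hi
        have a2 := (pt_pos k hk i).not.2 (h1 ▸ hi)
        omega
    · rintro rfl
      exact ⟨rfl, fun i => rfl⟩
  · intro x hx
    rw [sp_mem] at hx
    rcases Nat.eq_zero_or_pos x with h | h
    · subst h; exact absurd hx hk
    · exact h
  · intro i i' h
    have h1 := pt_anti m (show (i : ℕ) ≤ i' from le_of_lt h)
    have : (i : ℕ) < i' := h
    simp only
    omega
  · intro i
    have := (pt_pos m hm i).2 i.2
    have := i.2
    omega

theorem RR_expansion (k : Multiset ℕ) (hk : IsPartition k) (f : SymFn) (c : Multiset ℕ →₀ ℚ)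
    (h : SchurExpansion f c) : RR (sortedParts k) f = c k := by
  rw [h.2, Finsupp.sum, map_sum]
  rw [Finset.sum_congr rfl (g := fun m => if m = k then c m else 0)]
  · rw [Finset.sum_ite_eq']
    split_ifs with hh
    · rfl
    · rw [Finsupp.notMem_support_iff] at hh; exact hh.symm
  · intro m hm
    rw [map_smul, RR_schur k m hk (h.1 m hm)]
    simp

theorem RR_expansion_om (k : Multiset ℕ) (hk : IsPartition k) (f : SymFn) (c : Multiset ℕ →₀ ℚ)
    (h : SchurExpansion f c) : RR (sortedParts k) (om f) = c (conj k) := by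
  rw [h.2, Finsupp.sum, map_sum, map_sum]
  rw [Finset.sum_congr rfl (g := fun m => if m = conj k then c m else 0)]
  · rw [Finset.sum_ite_eq']
    split_ifs with hh
    · rfl
    · rw [Finsupp.notMem_support_iff] at hh; exact hh.symm
  · intro m hm
    rw [map_smul, map_smul, om_schur, RR_schur k _ hk (conj_part m)]
    have : conj m = k ↔ m = conj k := by
      constructor
      · rintro rfl; exact (conj_conj m (h.1 m hm)).symm
      · rintro rfl; exact conj_conj k hk
    simp [this]

end PartFive
section PartSix

theorem schur_SS_card (m : Multiset ℕ) (n : ℕ) (h : Multiset.card m = n) :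
    schur m = SS n (fun i => (pt m i : ℤ) - (i : ℕ)) := by
  subst h; exact schur_SS m

theorem Dl_PL_SS (g : SymFn) (n : ℕ) (α : Fin n → ℤ) :
    Dl (PL g (SS n α)) = (Matrix.of fun i j : Fin n => Dl (PL g (hh (α i + (j : ℤ))))).det := by
  rw [SS, AlgHom.map_det, AlgHom.map_det]
  rfl

theorem sum_pt (m : Multiset ℕ) : ∑ i : Fin (Multiset.card m), pt m i = m.sum := by
  rw [← Finset.sum_range (n := Multiset.card m) (pt m)]
  conv_rhs => rw [← sp_coe m, Multiset.sum_coe]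
  rw [← sp_length, Finset.sum_range, ← Fin.sum_univ_getElem]
  refine Finset.sum_congr rfl fun i _ => ?_
  rw [pt, List.getD_eq_getElem _ _ i.2]

theorem pt_cons_zero (k : ℕ) (m : Multiset ℕ) (h : ∀ x ∈ m, x ≤ k) : pt (k ::ₘ m) 0 = k := by
  rw [pt, sp_cons m k h]; rfl

theorem pt_cons_succ (k : ℕ) (m : Multiset ℕ) (h : ∀ x ∈ m, x ≤ k) (i : ℕ) :
    pt (k ::ₘ m) (i + 1) = pt m i := by
  rw [pt, sp_cons m k h]; rfl

theorem idx_padded (lam : Multiset ℕ) (k : ℕ) (h : ∀ x ∈ lam, x ≤ k)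
    (i : Fin (Multiset.card lam + 1)) :
    (pt (k ::ₘ lam) i : ℤ) = (Fin.cons (k : ℤ) (fun i : Fin (Multiset.card lam) => (pt lam i : ℤ)) :
      Fin (Multiset.card lam + 1) → ℤ) i := by
  refine Fin.cases ?_ (fun i => ?_) i
  · rw [Fin.cons_zero, Fin.val_zero, pt_cons_zero k lam h]
  · rw [Fin.cons_succ, Fin.val_succ, pt_cons_succ k lam h]

theorem MM_eq (n : ℕ) (l : Fin n → ℤ) (k : ℤ) (α : Fin (n+1) → ℤ)
    (h : ∀ i, α i = (Fin.cons k l : Fin (n+1) → ℤ) i - (i : ℕ)) :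
    (Matrix.of fun i j : Fin (n+1) => Dl (PL (hh 2) (hh (α i + (j : ℤ))))) = MM n l k := by
  ext1 i j
  rw [MM, Matrix.of_apply, Matrix.of_apply, BB, h]
  rw [show ∀ a b c : ℤ, a - b + c = a + c - b from fun a b c => by ring]

theorem Dl_padded (lam : Multiset ℕ) (k : ℕ) (h : ∀ x ∈ lam, x ≤ k) :
    Dl (PL (hh 2) (schur (k ::ₘ lam))) =
      (MM (Multiset.card lam) (fun i => (pt lam i : ℤ)) (k : ℤ)).det := by
  rw [schur_SS_card _ _ (Multiset.card_cons k lam), Dl_PL_SS]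
  exact congrArg Matrix.det (MM_eq _ _ _ _ fun i => by rw [idx_padded lam k h i])

theorem DegLe_mu (mu : Multiset ℕ) : DegLe (Dl (PL (ee 2) (schur mu))) (mu.sum : ℤ) := by
  rw [schur_SS, Dl_PL_SS]
  refine (DegLe_det _ (fun i => (pt mu i : ℤ) - (i : ℕ)) (fun j => (j : ℕ)) ?_).mono ?_
  · intro i j
    simp only [Matrix.of_apply, EE_eq]
    exact DegLe_AA qe (fun i => DegLe_q i _ _) _
  · rw [Finset.sum_sub_distrib, ← sum_pt mu]
    push_cast
    simp

/-- the product in the second expansion -/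
noncomputable def FF (lam mu : Multiset ℕ) (n : ℕ) : SymFn :=
  pleth (schur (padded lam (n - psize mu))) (hh 2) * pleth (schur mu) (ee 2)

theorem TT_step (lam mu : Multiset ℕ) (n N : ℕ) (h1 : psize lam + firstPart lam + psize mu ≤ n)
    (hN : 2 * N < n) :
    TT (2 * (n + 1) - N) (FF lam mu (n + 1)) = TT (2 * n - N) (FF lam mu n) := by
  rw [psize, psize, firstPart] at h1
  obtain ⟨k, hk⟩ : ∃ k, n = k + lam.sum + mu.sum := ⟨n - lam.sum - mu.sum, by omega⟩
  have hs : lam.sup ≤ lam.sum := Multiset.sup_le.2 fun x hx => Multiset.le_sum_of_mem hx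
  have hl : ∀ x ∈ lam, x ≤ k := fun x hx => by
    have := Multiset.le_sup hx
    omega
  have e0 : FF lam mu n = PL (hh 2) (schur (k ::ₘ lam)) * PL (ee 2) (schur mu) := by
    rw [FF, pleth_eq, pleth_eq, padded, psize, show n - mu.sum - lam.sum = k by omega]
  have e1 : FF lam mu (n + 1) = PL (hh 2) (schur ((k + 1) ::ₘ lam)) * PL (ee 2) (schur mu) := by
    rw [FF, pleth_eq, pleth_eq, padded, psize, show n + 1 - mu.sum - lam.sum = k + 1 by omega]
  have hd := MM_diff (Multiset.card lam) (fun i => (pt lam i : ℤ)) k lam.sup (by positivity) (by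
    intro i
    have := pt_le_sup lam i
    omega)
  have hs2 : ∑ i : Fin (Multiset.card lam), (pt lam i : ℤ) = lam.sum := by
    rw [← sum_pt lam]; push_cast; rfl
  rw [hs2] at hd
  have hm := hd.mul (DegLe_mu mu)
  rw [TT_apply, TT_apply, e0, e1, map_mul Dl, map_mul Dl, Dl_padded lam k hl,
    Dl_padded lam (k + 1) (fun x hx => (hl x hx).trans (Nat.le_succ k))]
  rw [← tau_shift (2 * n - N), show 2 * n - N + 2 = 2 * (n + 1) - N by omega, ← sub_eq_zero, ← map_sub,
    ← mul_assoc, ← sub_mul, Nat.cast_succ]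
  refine tau_DegLe hm ?_
  omega

theorem TT_const (lam mu : Multiset ℕ) (n n' N : ℕ) (h : n ≤ n')
    (h1 : psize lam + firstPart lam + psize mu ≤ n) (hN : 2 * N < n) :
    TT (2 * n' - N) (FF lam mu n') = TT (2 * n - N) (FF lam mu n) := by
  induction n', h using Nat.le_induction with
  | base => rfl
  | succ m hm ih => rw [TT_step lam mu m N (by omega) (by omega), ih]

theorem padded_part (nu : Multiset ℕ) (hnu : IsPartition nu) (n : ℕ) (h : 2 * psize nu < n) :
    IsPartition (padded nu (2 * n)) ∧
      sortedParts (padded nu (2 * n)) = (2 * n - psize nu) :: sortedParts nu := by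
  rw [psize] at *
  constructor
  · rw [IsPartition, padded, Multiset.mem_cons]
    rintro (h' | h')
    · omega
    · exact hnu h'
  · rw [padded, sp_cons]
    intro x hx
    have := Multiset.le_sum_of_mem hx
    omega

end PartSix
/-- For a partition `ν` and sufficiently large `n`, the multiplicity of
`V^{μ, λ[n-|μ|]}` in `Res^{S_{2n}}_{H_n}(V^{ν[2n]'})` — by Koike–Terada, the coefficient
of `s_{ν[2n]'}` in `(s_μ ∘ h₂)(s_{λ[n-|μ|]} ∘ e₂)` — equals the stable coefficient
`K̄^ν_{λ,μ}` of `s_{ν[2n']}` in `(s_{λ[n'-|μ|]} ∘ h₂)(s_μ ∘ e₂)` from the decomposition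
of `Res(V^{ν[2n']})`. -/
theorem conjugate_stability_theorem
    (nu : Multiset ℕ) (hnu : IsPartition nu) :
    ∃ n₀ : ℕ, ∀ n n' : ℕ, n₀ ≤ n → n₀ ≤ n' →
      ∀ lam mu : Multiset ℕ, IsPartition lam → IsPartition mu →
        psize lam + firstPart lam + psize mu ≤ n →
        psize lam + firstPart lam + psize mu ≤ n' →
        ∀ c c' : Multiset ℕ →₀ ℚ,
          SchurExpansion
            (pleth (schur mu) (hh 2) *
              pleth (schur (padded lam (n - psize mu))) (ee 2)) c →
          SchurExpansion
            (pleth (schur (padded lam (n' - psize mu))) (hh 2) *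
              pleth (schur mu) (ee 2)) c' →
          c (conj (padded nu (2 * n))) = c' (padded nu (2 * n')) := by
  refine ⟨2 * psize nu + 1, fun n n' hn hn' lam mu hlam hmu h1 h2 c c' hc hc' => ?_⟩
  obtain ⟨a1, a2⟩ := padded_part nu hnu n (by omega)
  obtain ⟨b1, b2⟩ := padded_part nu hnu n' (by omega)
  rw [← RR_expansion_om _ a1 _ c hc, ← RR_expansion _ b1 _ c' hc', a2, b2, RR_cons, RR_cons,
    map_mul, om_pleth_h2, om_pleth_e2, mul_comm (pleth (schur mu) (ee 2))]
  have key : TT (2 * n - psize nu) (FF lam mu n) = TT (2 * n' - psize nu) (FF lam mu n') := by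
    rcases le_total n n' with h | h
    · exact (TT_const lam mu n n' _ h h1 (by omega)).symm
    · exact TT_const lam mu n' n _ h h2 (by omega)
  exact congrArg (RR (sortedParts nu)) key
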